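/- arXiv:2103.09854 — 3 statements merged into one kernel-verified Lean document; each statement's English description precedes it below -/
import Mathlib

section
/- Under the balanced almost-abelian structure equations, if A is skew-symmetric (Kähler case), then for every τ ∈ ℝ and every α' ∈ ℝ the anomaly cancellation equation with flat bundle holds: i∂∂̄ω = (α'/4)·tr(Ω^τ∧Ω^τ) (both sides vanish identically). -/
noncomputable section

open Matrix

/-- The underlying vector space `ℝ⁶` of the almost-abelian Lie algebra. -/
abbrev V6 := Fin 6 → ℝ

/-- The standard basis `e₁, …, e₆` (0-indexed: `ee 0 = e₁`, …, `ee 5 = e₆`). -/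
def ee (i : Fin 6) : V6 := Pi.single i 1

/-- The complex structure `J`: `Je₁ = e₆, Je₂ = e₅, Je₃ = e₄, Je₄ = −e₃, Je₅ = −e₂, Je₆ = −e₁`. -/
def Jm (x : V6) : V6 := ![-x 5, -x 4, -x 3, x 2, x 1, x 0]

/-- The matrix of `J` restricted to `n₁ = span(e₂,e₃,e₄,e₅)` in the basis `(e₂,e₃,e₄,e₅)`. -/
def J4 : Matrix (Fin 4) (Fin 4) ℝ := !![0,0,0,-1; 0,0,-1,0; 0,1,0,0; 1,0,0,0]

/-- The matrix `A` of `ad_{e₆}|_{n₁}` in the basis `(e₂,e₃,e₄,e₅)` determined by the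
balanced almost-abelian structure equations with parameters
`p = A₂², q = A₂³, r = A₂⁴, s = A₂⁵, u = A₃², w = A₃⁵`. -/
def Amat (p q r s u w : ℝ) : Matrix (Fin 4) (Fin 4) ℝ :=
  !![p, q, r, s; u, -p, -s, w; -w, s, -p, u; -s, -r, q, p]

/-- The derivation `ad_{e₆}` of the abelian ideal `n`, given by the balanced
almost-abelian structure equations. -/
def bD (p q r s u w : ℝ) (x : V6) : V6 :=
  ![0,
    p * x 1 + q * x 2 + r * x 3 + s * x 4,
    u * x 1 - p * x 2 - s * x 3 + w * x 4,
    -w * x 1 + s * x 2 - p * x 3 + u * x 4,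
    -s * x 1 - r * x 2 + q * x 3 + p * x 4,
    0]

/-- The balanced almost-abelian Lie bracket on `ℝ⁶`. -/
def br (p q r s u w : ℝ) (x y : V6) : V6 :=
  fun i => x 5 * bD p q r s u w y i - y 5 * bD p q r s u w x i

/-- The fundamental 2-form `ω = e^{16} + e^{25} + e^{34}`. -/
def omega2 (x y : V6) : ℝ :=
  (x 0 * y 5 - x 5 * y 0) + (x 1 * y 4 - x 4 * y 1) + (x 2 * y 3 - x 3 * y 2)

/-- Chevalley–Eilenberg differential of a 1-form. -/
def d1 (B : V6 → V6 → V6) (α : V6 → ℝ) (x0 x1 : V6) : ℝ := -α (B x0 x1)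

/-- Chevalley–Eilenberg differential of a 2-form. -/
def d2 (B : V6 → V6 → V6) (α : V6 → V6 → ℝ) (x0 x1 x2 : V6) : ℝ :=
  -α (B x0 x1) x2 + α (B x0 x2) x1 - α (B x1 x2) x0

/-- Chevalley–Eilenberg differential of a 3-form. -/
def d3 (B : V6 → V6 → V6) (α : V6 → V6 → V6 → ℝ) (x0 x1 x2 x3 : V6) : ℝ :=
  -α (B x0 x1) x2 x3 + α (B x0 x2) x1 x3 - α (B x0 x3) x1 x2
    - α (B x1 x2) x0 x3 + α (B x1 x3) x0 x2 - α (B x2 x3) x0 x1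

/-- Structure constants `c^i_{jk} = e^i([e_j, e_k])` of the Lie bracket,
i.e. `[e_j, e_k] = Σ_i c^i_{jk} e_i`, entering the Koszul/Gauduchon formula for `σ^τ`. -/
def cst (p q r s u w : ℝ) (i j k : Fin 6) : ℝ := (br p q r s u w (ee j) (ee k)) i

/-- The 3-form `dω`. -/
def dOmega (p q r s u w : ℝ) : V6 → V6 → V6 → ℝ := d2 (br p q r s u w) omega2

/-- The Gauduchon connection 1-forms
`(σ^τ)^i_j(e_k) = ½(c^i_{jk} − c^k_{ij} + c^j_{ki}) + ((τ−1)/4)·dω(Je_k,Je_j,Je_i)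
  + ((τ+1)/4)·dω(Je_k,e_j,e_i)`, extended linearly. -/
def sigma (p q r s u w τ : ℝ) (i j : Fin 6) : V6 → ℝ := fun x =>
  ∑ k : Fin 6, x k *
    ((1/2) * (cst p q r s u w i j k - cst p q r s u w k i j + cst p q r s u w j k i)
      + (τ - 1)/4 * dOmega p q r s u w (Jm (ee k)) (Jm (ee j)) (Jm (ee i))
      + (τ + 1)/4 * dOmega p q r s u w (Jm (ee k)) (ee j) (ee i))

/-- Wedge product of two 1-forms. -/
def w11 (α β : V6 → ℝ) (x0 x1 : V6) : ℝ := α x0 * β x1 - α x1 * β x0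

/-- The curvature 2-forms `(Ω^τ)^i_j = d(σ^τ)^i_j + Σ_k (σ^τ)^i_k ∧ (σ^τ)^k_j`. -/
def Omega (p q r s u w τ : ℝ) (i j : Fin 6) (x0 x1 : V6) : ℝ :=
  d1 (br p q r s u w) (sigma p q r s u w τ i j) x0 x1
    + ∑ k : Fin 6, w11 (sigma p q r s u w τ i k) (sigma p q r s u w τ k j) x0 x1

/-- Wedge product of two 2-forms. -/
def w22 (α β : V6 → V6 → ℝ) (x0 x1 x2 x3 : V6) : ℝ :=
  α x0 x1 * β x2 x3 - α x0 x2 * β x1 x3 + α x0 x3 * β x1 x2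
    + α x1 x2 * β x0 x3 - α x1 x3 * β x0 x2 + α x2 x3 * β x0 x1

/-- The 4-form `tr(Ω^τ ∧ Ω^τ) = Σ_{i<j} (Ω^τ)^i_j ∧ (Ω^τ)^i_j`. -/
def trOmOm (p q r s u w τ : ℝ) (x0 x1 x2 x3 : V6) : ℝ :=
  ∑ i : Fin 6, ∑ j : Fin 6,
    if i < j then w22 (Omega p q r s u w τ i j) (Omega p q r s u w τ i j) x0 x1 x2 x3 else 0

/-- The 3-form `d^cω(X,Y,Z) = −dω(JX,JY,JZ)`. -/
def dcOmega (p q r s u w : ℝ) (x0 x1 x2 : V6) : ℝ :=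
  -dOmega p q r s u w (Jm x0) (Jm x1) (Jm x2)

/-- The 4-form `i∂∂̄ω = d(d^cω)`. -/
def iddbar (p q r s u w : ℝ) : V6 → V6 → V6 → V6 → ℝ :=
  d3 (br p q r s u w) (dcOmega p q r s u w)

/-- The basis 4-form `e^i ∧ e^j ∧ e^k ∧ e^l` (0-indexed). -/
def E4 (i j k l : Fin 6) (x0 x1 x2 x3 : V6) : ℝ :=
  Matrix.det !![x0 i, x0 j, x0 k, x0 l; x1 i, x1 j, x1 k, x1 l;
                x2 i, x2 j, x2 k, x2 l; x3 i, x3 j, x3 k, x3 l]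

/-- In the Kähler case the parameters satisfy `p = 0`, `u = -q`, `w = r`. -/
theorem kahler_params (p q r s u w : ℝ)
    (h : Amat p q r s u w + (Amat p q r s u w)ᵀ = 0) : p = 0 ∧ u = -q ∧ w = r := by
  have h00 := congrFun (congrFun h 0) 0
  have h01 := congrFun (congrFun h 0) 1
  have h02 := congrFun (congrFun h 0) 2
  simp [Amat] at h00 h01 h02
  refine ⟨by linarith, by linarith, by linarith⟩

/-- In the Kähler case `dω = 0`. -/
theorem dOmega_zero (q r s : ℝ) (x y z : V6) : dOmega 0 q r s (-q) r x y z = 0 := by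
  simp [dOmega, d2, omega2, br, bD]
  ring

/-- The Levi-Civita coefficients vanish in the directions of the abelian ideal. -/
theorem coeff_zero (q r s : ℝ) (i j k : Fin 6) (hk : k ≠ 5) :
    cst 0 q r s (-q) r i j k - cst 0 q r s (-q) r k i j + cst 0 q r s (-q) r j k i = 0 := by
  fin_cases i <;> fin_cases j <;> fin_cases k <;>
    first
    | exact absurd rfl hk
    | simp [cst, br, bD, ee, Pi.single_apply]

theorem sigma_eq (q r s τ : ℝ) (i j : Fin 6) (x : V6) :
    sigma 0 q r s (-q) r τ i j x = x 5 * sigma 0 q r s (-q) r τ i j (ee 5) := by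
  simp only [sigma, dOmega_zero]
  rw [Finset.sum_eq_single 5, Finset.sum_eq_single 5]
  · simp [ee]
  · intro k _ hk
    rw [coeff_zero q r s i j k hk]; simp
  · simp
  · intro k _ hk
    rw [coeff_zero q r s i j k hk]; simp
  · simp

theorem Omega_zero (q r s τ : ℝ) (i j : Fin 6) (x y : V6) :
    Omega 0 q r s (-q) r τ i j x y = 0 := by
  have h1 : br 0 q r s (-q) r x y 5 = 0 := by simp [br, bD]
  unfold Omega d1 w11
  rw [sigma_eq, h1, Finset.sum_eq_zero]
  · ring
  · intro k _
    rw [sigma_eq q r s τ i k x, sigma_eq q r s τ i k y, sigma_eq q r s τ k j x,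
      sigma_eq q r s τ k j y]
    ring

/-- Under the balanced almost-abelian structure equations, if `A` is
skew-symmetric (Kähler case), then for every `τ ∈ ℝ` and every `α' ∈ ℝ` the anomaly
cancellation equation with flat bundle holds: `i∂∂̄ω = (α'/4)·tr(Ω^τ∧Ω^τ)`. -/
theorem stmt8 (p q r s u w : ℝ)
    (hKahler : Amat p q r s u w + (Amat p q r s u w)ᵀ = 0) (τ α' : ℝ) :
    ∀ x0 x1 x2 x3 : V6,
      iddbar p q r s u w x0 x1 x2 x3 = α' / 4 * trOmOm p q r s u w τ x0 x1 x2 x3 := by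
  obtain ⟨rfl, rfl, rfl⟩ := kahler_params p q r s u w hKahler
  intro x0 x1 x2 x3
  simp [iddbar, d3, dcOmega, dOmega_zero, trOmOm, w22, Omega_zero]
end
end

section
/- Let A : [0,T) → Mₙ(ℝ) be a differentiable solution of the reduced Anomaly flow ODE A′(t) = f(A(t))·(2[[A(t)⁺,A(t)⁻],A(t)] − ‖A(t)⁺‖²·A(t)) with f(A(0)) > 0. Then f(A(t)) > 0 for every t ∈ [0,T). -/
noncomputable section

open Matrix

attribute [local instance] Matrix.normedAddCommGroup Matrix.normedSpace

/-- The symmetric part `X⁺ = (X + Xᵀ)/2` of a square matrix. -/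
def symPart {n : ℕ} (X : Matrix (Fin n) (Fin n) ℝ) : Matrix (Fin n) (Fin n) ℝ :=
  (1/2 : ℝ) • (X + Xᵀ)

/-- The skew-symmetric part `X⁻ = (X − Xᵀ)/2` of a square matrix. -/
def skewPart {n : ℕ} (X : Matrix (Fin n) (Fin n) ℝ) : Matrix (Fin n) (Fin n) ℝ :=
  (1/2 : ℝ) • (X - Xᵀ)

/-- The matrix commutator `[X, Y] = XY − YX`. -/
def mcomm {n : ℕ} (X Y : Matrix (Fin n) (Fin n) ℝ) : Matrix (Fin n) (Fin n) ℝ :=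
  X * Y - Y * X

/-- The squared Frobenius norm `‖X‖² = ⟨X, X⟩ = tr(XXᵀ)`. -/
def nsq {n : ℕ} (X : Matrix (Fin n) (Fin n) ℝ) : ℝ := Matrix.trace (X * Xᵀ)

/-- `f(X) = 1 − c‖X⁺‖²`, where `c` corresponds to `(α'/4)·(τ(τ−1)²/8)`. -/
def fval (c : ℝ) {n : ℕ} (X : Matrix (Fin n) (Fin n) ℝ) : ℝ := 1 - c * nsq (symPart X)

/-- The right-hand side of the reduced Anomaly flow ODE:
`f(X)·(2[[X⁺,X⁻],X] − ‖X⁺‖²·X)`. -/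
def rhs (c : ℝ) {n : ℕ} (X : Matrix (Fin n) (Fin n) ℝ) : Matrix (Fin n) (Fin n) ℝ :=
  fval c X • ((2 : ℝ) • mcomm (mcomm (symPart X) (skewPart X)) X - nsq (symPart X) • X)

/-- The bracket part of the flow, without the scalar factor `f`. -/
def flowG {n : ℕ} (X : Matrix (Fin n) (Fin n) ℝ) : Matrix (Fin n) (Fin n) ℝ :=
  (2 : ℝ) • mcomm (mcomm (symPart X) (skewPart X)) X - nsq (symPart X) • X

/-- The logarithmic derivative of `f` along the flow. -/
def flowK (c : ℝ) {n : ℕ} (X : Matrix (Fin n) (Fin n) ℝ) : ℝ :=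
  -c * ∑ i, ∑ j, 2 * symPart X i j * symPart (flowG X) i j

lemma continuous_flowK (c : ℝ) (n : ℕ) :
    Continuous (fun X : Matrix (Fin n) (Fin n) ℝ => flowK c X) := by
  have h1 : Continuous (fun X : Matrix (Fin n) (Fin n) ℝ => symPart X) := by
    unfold symPart; fun_prop
  have h2 : Continuous (fun X : Matrix (Fin n) (Fin n) ℝ => skewPart X) := by
    unfold skewPart; fun_prop
  have h3 : Continuous (fun X : Matrix (Fin n) (Fin n) ℝ => nsq (symPart X)) := by
    unfold nsq
    exact (h1.matrix_mul h1.matrix_transpose).matrix_trace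
  have h4 : Continuous (fun X : Matrix (Fin n) (Fin n) ℝ => flowG X) := by
    unfold flowG mcomm
    have h5 := (h1.matrix_mul h2).sub (h2.matrix_mul h1)
    exact (((h5.matrix_mul continuous_id).sub (continuous_id.matrix_mul h5)).const_smul
      (2 : ℝ)).sub (h3.smul continuous_id)
  unfold flowK
  refine continuous_const.mul (continuous_finset_sum _ fun i _ =>
    continuous_finset_sum _ fun j _ => ?_)
  exact (continuous_const.mul (h1.matrix_elem i j)).mul ((h1.comp h4).matrix_elem i j)

lemma nsq_eq_sum {n : ℕ} (X : Matrix (Fin n) (Fin n) ℝ) :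
    nsq X = ∑ i, ∑ j, X i j ^ 2 := by
  simp [nsq, Matrix.trace, Matrix.mul_apply, pow_two]

lemma hasDeriv_fval (c : ℝ) (n : ℕ) (S : Set ℝ) (t : ℝ)
    (A : ℝ → Matrix (Fin n) (Fin n) ℝ)
    (hA : HasDerivWithinAt A (rhs c (A t)) S t) :
    HasDerivWithinAt (fun s => fval c (A s)) (fval c (A t) * flowK c (A t)) S t := by
  have he : ∀ i j, HasDerivWithinAt (fun s => A s i j) (rhs c (A t) i j) S t := by
    intro i j
    exact hasDerivWithinAt_pi.1 (hasDerivWithinAt_pi.1 hA i) j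
  have hs : ∀ i j, HasDerivWithinAt (fun s => symPart (A s) i j)
      (symPart (rhs c (A t)) i j) S t := by
    intro i j
    exact ((he i j).add (he j i)).const_mul (1/2 : ℝ)
  have hq : HasDerivWithinAt (fun s => ∑ i, ∑ j, symPart (A s) i j ^ 2)
      (∑ i, ∑ j, 2 * symPart (A t) i j * symPart (rhs c (A t)) i j) S t := by
    refine HasDerivWithinAt.fun_sum fun i _ => HasDerivWithinAt.fun_sum fun j _ => ?_
    simpa using (hs i j).fun_pow 2
  have hf := (hq.const_mul c).const_sub 1
  simp only [← nsq_eq_sum] at hf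
  refine hf.congr_deriv ?_
  have hr : ∀ i j, symPart (rhs c (A t)) i j
      = fval c (A t) * symPart (flowG (A t)) i j := by
    intro i j
    change (1/2 : ℝ) * (fval c (A t) * flowG (A t) i j + fval c (A t) * flowG (A t) j i)
      = fval c (A t) * ((1/2 : ℝ) * (flowG (A t) i j + flowG (A t) j i))
    ring
  simp only [hr, flowK, Finset.mul_sum, ← Finset.sum_neg_distrib]
  refine Finset.sum_congr rfl fun i _ => Finset.sum_congr rfl fun j _ => ?_
  ring

/-- A solution of a scalar linear ODE `u' = u k` that is nonzero initially stays nonzero. -/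
lemma linear_ne_zero (T : ℝ) (u k : ℝ → ℝ)
    (hu : ∀ t ∈ Set.Ico (0 : ℝ) T, HasDerivWithinAt u (u t * k t) (Set.Ico 0 T) t)
    (hk : ContinuousOn k (Set.Ico 0 T)) (h0 : u 0 ≠ 0) :
    ∀ t ∈ Set.Ico (0 : ℝ) T, u t ≠ 0 := by
  intro t ht hz
  have hsub : Set.Icc 0 t ⊆ Set.Ico 0 T := fun s hs => ⟨hs.1, hs.2.trans_lt ht.2⟩
  obtain ⟨K, hK⟩ := isCompact_Icc.exists_bound_of_continuousOn (hk.mono hsub)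
  have hd : ∀ s ∈ Set.Icc 0 t, HasDerivWithinAt (fun s => u s ^ 2 * Real.exp (2 * K * s))
      (2 * u s ^ 2 * (k s + K) * Real.exp (2 * K * s)) (Set.Icc 0 t) s := by
    intro s hs
    have h1 := ((hu s (hsub hs)).mono hsub).fun_pow 2
    have h2 : HasDerivWithinAt (fun s => Real.exp (2 * K * s))
        (Real.exp (2 * K * s) * (2 * K * 1)) (Set.Icc 0 t) s :=
      (((hasDerivAt_id s).const_mul (2 * K)).exp).hasDerivWithinAt
    refine (h1.fun_mul h2).congr_deriv ?_
    push_cast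
    ring
  have hm : MonotoneOn (fun s => u s ^ 2 * Real.exp (2 * K * s)) (Set.Icc 0 t) := by
    refine monotoneOn_of_hasDerivWithinAt_nonneg (convex_Icc 0 t)
      (fun s hs => (hd s hs).continuousWithinAt)
      (fun s hs => (hd s (interior_subset hs)).mono interior_subset) ?_
    intro s hs
    have := (abs_le.1 (hK s (interior_subset hs))).1
    have : 0 ≤ k s + K := by linarith
    positivity
  have := hm ⟨le_refl 0, ht.1⟩ ⟨ht.1, le_refl t⟩ ht.1
  simp only [hz, mul_zero, Real.exp_zero, mul_one] at this
  have h3 : 0 < u 0 ^ 2 := by positivity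
  norm_num at this
  exact h0 this

/-- Let `A : [0,T) → Mₙ(ℝ)` be a differentiable solution of the reduced
Anomaly flow ODE `A′ = f(A)·(2[[A⁺,A⁻],A] − ‖A⁺‖²A)` with `f(A(0)) > 0`. Then
`f(A(t)) > 0` for every `t ∈ [0,T)`. -/
theorem stmt15 (c : ℝ) (n : ℕ) (T : ℝ) (hT : 0 < T)
    (A : ℝ → Matrix (Fin n) (Fin n) ℝ)
    (hA : ∀ t ∈ Set.Ico (0 : ℝ) T, HasDerivWithinAt A (rhs c (A t)) (Set.Ico 0 T) t)
    (h0 : 0 < fval c (A 0)) :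
    ∀ t ∈ Set.Ico (0 : ℝ) T, 0 < fval c (A t) := by
  have hu : ∀ t ∈ Set.Ico (0 : ℝ) T, HasDerivWithinAt (fun s => fval c (A s))
      (fval c (A t) * flowK c (A t)) (Set.Ico 0 T) t :=
    fun t ht => hasDeriv_fval c n _ t A (hA t ht)
  have hAc : ContinuousOn A (Set.Ico 0 T) := fun t ht => (hA t ht).continuousWithinAt
  have hne := linear_ne_zero T (fun s => fval c (A s)) (fun s => flowK c (A s)) hu
    ((continuous_flowK c n).comp_continuousOn hAc) h0.ne'
  intro t ht
  by_contra hneg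
  have hsub : Set.Icc 0 t ⊆ Set.Ico 0 T := fun s hs => ⟨hs.1, hs.2.trans_lt ht.2⟩
  have hc : ContinuousOn (fun s => fval c (A s)) (Set.Icc 0 t) :=
    fun s hs => ((hu s (hsub hs)).continuousWithinAt).mono hsub
  obtain ⟨s, hs, hs0⟩ := intermediate_value_Icc' ht.1 hc ⟨not_lt.1 hneg, h0.le⟩
  exact hne s (hsub hs) hs0
end
end

section
/- Let A : [0,∞) → M₄(ℝ) be a differentiable solution of A′(t) = 2[[A(t)⁺,A(t)⁻],A(t)] − ‖A(t)⁺‖²·A(t) (the reduced Anomaly flow with α' = 0) such that A(0) commutes with J₄, where J₄ acts on the basis (e₂,e₃,e₄,e₅) by J₄e₂ = e₅, J₄e₃ = e₄, J₄e₄ = −e₃, J₄e₅ = −e₂. If, for some sequence t_k → ∞, the matrices A(t_k) converge to a matrix Ā, then Ā + Āᵀ = 0 and Ā commutes with J₄; that is, every accumulation point of the flow lies in the unitary Lie algebra u(n₁), corresponding to a Kähler limit structure. -/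
noncomputable section

open Matrix

attribute [local instance] Matrix.normedAddCommGroup Matrix.normedSpace

abbrev M4 := Matrix (Fin 4) (Fin 4) ℝ

theorem entry_cd (F : M4 → M4) (h : ∀ i j, ContDiff ℝ 1 (fun X => F X i j)) : ContDiff ℝ 1 F :=
  contDiff_pi.2 fun i => contDiff_pi.2 fun j => h i j

theorem cd_entry {F : M4 → M4} (h : ContDiff ℝ 1 F) (i j : Fin 4) :
    ContDiff ℝ 1 (fun X => F X i j) :=
  contDiff_pi.1 (contDiff_pi.1 h i) j

theorem cd_mul {F G : M4 → M4} (hF : ContDiff ℝ 1 F) (hG : ContDiff ℝ 1 G) :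
    ContDiff ℝ 1 (fun X => F X * G X) := by
  apply entry_cd
  intro i j
  simp only [Matrix.mul_apply]
  exact ContDiff.sum fun k _ => (cd_entry hF i k).mul (cd_entry hG k j)

theorem cd_transpose {F : M4 → M4} (hF : ContDiff ℝ 1 F) :
    ContDiff ℝ 1 (fun X => (F X)ᵀ) :=
  entry_cd _ fun i j => cd_entry hF j i

theorem cd_nsq {F : M4 → M4} (hF : ContDiff ℝ 1 F) :
    ContDiff ℝ 1 (fun X => nsq (F X)) := by
  unfold nsq Matrix.trace
  exact ContDiff.sum fun k _ => cd_entry (cd_mul hF (cd_transpose hF)) k k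

theorem cd_sym : ContDiff ℝ 1 (fun X : M4 => symPart X) :=
  (contDiff_id.add (cd_transpose contDiff_id)).const_smul (1/2 : ℝ)

theorem cd_skew : ContDiff ℝ 1 (fun X : M4 => skewPart X) :=
  (contDiff_id.sub (cd_transpose contDiff_id)).const_smul (1/2 : ℝ)

theorem cd_mcomm {F G : M4 → M4} (hF : ContDiff ℝ 1 F) (hG : ContDiff ℝ 1 G) :
    ContDiff ℝ 1 (fun X => mcomm (F X) (G X)) :=
  (cd_mul hF hG).sub (cd_mul hG hF)

theorem rhs_zero (X : M4) : rhs 0 X =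
    (2 : ℝ) • mcomm (mcomm (symPart X) (skewPart X)) X - nsq (symPart X) • X := by
  simp [rhs, fval]

theorem cd_rhs : ContDiff ℝ 1 (fun X : M4 => rhs 0 X) := by
  simp only [rhs_zero]
  exact ((cd_mcomm (cd_mcomm cd_sym cd_skew) contDiff_id).const_smul (2 : ℝ)).sub
    ((cd_nsq cd_sym).smul contDiff_id)

theorem nsq_eq (X : M4) : nsq X = ∑ i, ∑ j, X i j ^ 2 := by
  simp [nsq, Matrix.trace, Matrix.mul_apply, sq]

theorem nsq_nonneg (X : M4) : 0 ≤ nsq X := by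
  rw [nsq_eq]; positivity

theorem nsq_eq_zero {X : M4} (h : nsq X = 0) : X = 0 := by
  ext i j
  rw [nsq_eq, Finset.sum_eq_zero_iff_of_nonneg (fun _ _ => by positivity)] at h
  have := h i (Finset.mem_univ _)
  rw [Finset.sum_eq_zero_iff_of_nonneg (fun _ _ => by positivity)] at this
  simpa using this j (Finset.mem_univ _)

theorem entry_sq_le (X : M4) (i j : Fin 4) : X i j ^ 2 ≤ nsq X := by
  rw [nsq_eq]
  calc X i j ^ 2 ≤ ∑ j, X i j ^ 2 :=
        Finset.single_le_sum (f := fun j => X i j ^ 2) (fun _ _ => by positivity) (Finset.mem_univ j)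
    _ ≤ _ := Finset.single_le_sum (f := fun i => ∑ j, X i j ^ 2)
        (fun _ _ => by positivity) (Finset.mem_univ i)

theorem norm_le_of_nsq {X : M4} {R : ℝ} (h : nsq X ≤ R) : ‖X‖ ≤ Real.sqrt R := by
  rw [Matrix.norm_le_iff (Real.sqrt_nonneg _)]
  intro i j
  rw [Real.norm_eq_abs]
  exact Real.abs_le_sqrt ((entry_sq_le X i j).trans h)

theorem energy (X : M4) :
    2 * Matrix.trace (rhs 0 X * Xᵀ) ≤ - (2 * (nsq (symPart X) * nsq X)) := by
  set M := mcomm (symPart X) (skewPart X) with hM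
  have hc : X * Xᵀ - Xᵀ * X = (-2 : ℝ) • M := by
    rw [hM]
    simp only [mcomm, symPart, skewPart, smul_mul_assoc, mul_smul_comm, add_mul, mul_add,
      sub_mul, mul_sub]
    module
  have hMt : Mᵀ = M := by
    have h2 : M = (-1/2 : ℝ) • (X * Xᵀ - Xᵀ * X) := by rw [hc]; module
    rw [h2]
    simp [Matrix.transpose_sub, Matrix.transpose_mul]
  have h1 : Matrix.trace (mcomm M X * Xᵀ) = -2 * nsq M := by
    have : Matrix.trace (mcomm M X * Xᵀ) = Matrix.trace (M * (X * Xᵀ - Xᵀ * X)) := by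
      simp only [mcomm, sub_mul, mul_sub, Matrix.trace_sub, mul_assoc]
      congr 1
      rw [Matrix.trace_mul_comm, mul_assoc]
    rw [this, hc, nsq, hMt]
    simp
  have h3 := nsq_nonneg M
  rw [rhs_zero, ← hM, sub_mul, Matrix.trace_sub, smul_mul_assoc, smul_mul_assoc,
    Matrix.trace_smul, Matrix.trace_smul, h1]
  change 2 * ((2:ℝ) * _ - nsq (symPart X) * nsq X) ≤ _
  linarith

theorem nsq_sym_le (X : M4) : nsq (symPart X) ≤ nsq X := by
  have : nsq X = nsq (symPart X) + nsq (skewPart X) := by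
    simp only [nsq_eq, symPart, skewPart, Fin.sum_univ_four, Matrix.smul_apply, Matrix.add_apply,
      Matrix.sub_apply, Matrix.transpose_apply, smul_eq_mul]
    ring
  linarith [nsq_nonneg (skewPart X)]

theorem energy' (X : M4) :
    2 * Matrix.trace (rhs 0 X * Xᵀ) ≤ - (2 * (nsq (symPart X)) ^ 2) := by
  have := energy X
  nlinarith [nsq_nonneg (symPart X), nsq_sym_le X]

theorem nsq_deriv {A : ℝ → M4} {A' : M4} {s : Set ℝ} {t : ℝ} (h : HasDerivWithinAt A A' s t) :
    HasDerivWithinAt (fun t => nsq (A t)) (2 * Matrix.trace (A' * (A t)ᵀ)) s t := by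
  have he : ∀ i j, HasDerivWithinAt (fun t => A t i j) (A' i j) s t := fun i j =>
    hasDerivWithinAt_pi.1 (hasDerivWithinAt_pi.1 h i) j
  have := HasDerivWithinAt.fun_sum (u := Finset.univ) fun i _ =>
    HasDerivWithinAt.fun_sum (u := Finset.univ) fun j _ => (he i j).fun_pow 2
  simp only [nsq_eq]
  refine this.congr_deriv ?_
  symm
  simp only [Matrix.trace, Matrix.diag, Matrix.mul_apply, Matrix.transpose_apply, Finset.mul_sum]
  refine Finset.sum_congr rfl fun i _ => Finset.sum_congr rfl fun j _ => ?_
  norm_num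
  ring

theorem decr {f f' : ℝ → ℝ} (hf : ∀ t ∈ Set.Ici (0:ℝ), HasDerivWithinAt f (f' t) (Set.Ici 0) t)
    {a b d : ℝ} (ha : 0 ≤ a) (hab : a ≤ b) (hd : ∀ t ∈ Set.Icc a b, f' t ≤ - d) :
    f b ≤ f a - d * (b - a) := by
  have := image_le_of_deriv_right_le_deriv_boundary (f := f) (f' := f') (a := a) (b := b)
    (B := fun t => f a - d * (t - a)) (B' := fun _ => - d)
    (fun t ht => ((hf t (ha.trans ht.1)).continuousWithinAt).mono
      fun x hx => ha.trans hx.1)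
    (fun t ht => (hf t (ha.trans ht.1)).mono fun x hx => (ha.trans ht.1).trans hx)
    (by simp) (by fun_prop)
    (fun t _ => by
      have := ((((hasDerivAt_id t).sub_const a).const_mul d).const_sub (f a)).hasDerivWithinAt
        (s := Set.Ici t)
      simpa using this)
    (fun t ht => hd t ⟨ht.1, ht.2.le⟩)
  exact this ⟨hab, le_rfl⟩

theorem J4_sq : J4 * J4 = -1 := by
  ext i j
  fin_cases i <;> fin_cases j <;> simp [J4, Matrix.mul_apply, Fin.sum_univ_four]

theorem J4_t : J4ᵀ = -J4 := by
  ext i j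
  fin_cases i <;> fin_cases j <;> simp [J4]

/-- conjugation by `J4` -/
def conjJ (X : M4) : M4 := -(J4 * X * J4)

theorem conjJ_mul (X Y : M4) : conjJ (X * Y) = conjJ X * conjJ Y := by
  have : J4 * X * J4 * (J4 * Y * J4) = J4 * X * (J4 * J4) * Y * J4 := by noncomm_ring
  simp only [conjJ, neg_mul_neg, this, J4_sq]
  noncomm_ring

theorem conjJ_add (X Y : M4) : conjJ (X + Y) = conjJ X + conjJ Y := by
  simp only [conjJ]; noncomm_ring

theorem conjJ_sub (X Y : M4) : conjJ (X - Y) = conjJ X - conjJ Y := by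
  simp only [conjJ]; noncomm_ring

theorem conjJ_smul (c : ℝ) (X : M4) : conjJ (c • X) = c • conjJ X := by
  simp [conjJ]

theorem conjJ_t (X : M4) : conjJ Xᵀ = (conjJ X)ᵀ := by
  simp [conjJ, J4_t, Matrix.transpose_mul, mul_assoc]

theorem conjJ_nsq (X : M4) : nsq (conjJ X) = nsq X := by
  rw [nsq, ← conjJ_t, ← conjJ_mul, conjJ, Matrix.trace_neg, mul_assoc, Matrix.trace_mul_comm,
    mul_assoc, J4_sq, nsq]
  simp

theorem conjJ_rhs (X : M4) : conjJ (rhs 0 X) = rhs 0 (conjJ X) := by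
  have hs : symPart (conjJ X) = conjJ (symPart X) := by
    simp only [symPart, conjJ_smul, conjJ_add, conjJ_t]
  have hk : skewPart (conjJ X) = conjJ (skewPart X) := by
    simp only [skewPart, conjJ_smul, conjJ_sub, conjJ_t]
  simp only [rhs_zero, hs, hk, conjJ_nsq, mcomm, conjJ_sub, conjJ_smul, conjJ_mul]

theorem conjJ_iff (X : M4) : conjJ X = X ↔ X * J4 = J4 * X := by
  constructor
  · intro h
    have h2 : J4 * conjJ X = X * J4 := by
      have : J4 * conjJ X = -((J4 * J4) * X * J4) := by simp only [conjJ]; noncomm_ring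
      rw [this, J4_sq]; noncomm_ring
    rw [← h2, h]
  · intro h
    rw [conjJ, ← h, mul_assoc, J4_sq]; simp

theorem conjJ_deriv {A : ℝ → M4} {A' : M4} {s : Set ℝ} {t : ℝ} (h : HasDerivWithinAt A A' s t) :
    HasDerivWithinAt (fun t => conjJ (A t)) (conjJ A') s t := by
  let L : M4 →ₗ[ℝ] M4 := 
    { toFun := conjJ, map_add' := conjJ_add, map_smul' := conjJ_smul }
  exact (L.toContinuousLinearMap.hasFDerivAt (x := A t)).comp_hasDerivWithinAt t h

/-- Let `A : [0,∞) → M₄(ℝ)` be a differentiable solution of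
`A′ = 2[[A⁺,A⁻],A] − ‖A⁺‖²A` (the reduced Anomaly flow with `α' = 0`, i.e. `c = 0`,
`f ≡ 1`) with `A(0)` commuting with `J₄`. If, for some sequence `t_k → ∞`, the matrices
`A(t_k)` converge to `Ā`, then `Ā + Āᵀ = 0` and `Ā` commutes with `J₄`; that is, every
accumulation point lies in `u(n₁)`, corresponding to a Kähler limit structure. -/
theorem stmt18 (A : ℝ → Matrix (Fin 4) (Fin 4) ℝ)
    (hA : ∀ t ∈ Set.Ici (0 : ℝ), HasDerivWithinAt A (rhs 0 (A t)) (Set.Ici 0) t)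
    (hJ : A 0 * J4 = J4 * A 0)
    (t : ℕ → ℝ) (ht0 : ∀ k, 0 ≤ t k) (ht : Filter.Tendsto t Filter.atTop Filter.atTop)
    (Abar : Matrix (Fin 4) (Fin 4) ℝ)
    (hconv : Filter.Tendsto (fun k => A (t k)) Filter.atTop (nhds Abar)) :
    Abar + Abarᵀ = 0 ∧ Abar * J4 = J4 * Abar := by
  have hcont : ContinuousOn A (Set.Ici 0) := fun t ht => (hA t ht).continuousWithinAt
  constructor
  · -- skew-symmetry by a Barbalat type argument
    have hN := fun t ht => nsq_deriv (hA t ht)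
    have hanti : ∀ a b, 0 ≤ a → a ≤ b → nsq (A b) ≤ nsq (A a) := by
      intro a b ha hab
      have := decr (d := 0) hN ha hab (fun t _ => by
        have := energy' (A t)
        nlinarith [sq_nonneg (nsq (symPart (A t)))])
      simpa using this
    have hnc : Continuous (fun X : M4 => nsq X) := (cd_nsq contDiff_id).continuous
    have hlim : Filter.Tendsto (fun k => nsq (A (t k))) Filter.atTop (nhds (nsq Abar)) :=
      (hnc.tendsto Abar).comp hconv
    have hlow : ∀ b, 0 ≤ b → nsq Abar ≤ nsq (A b) := by
      intro b hb
      refine le_of_tendsto hlim ?_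
      filter_upwards [ht.eventually_ge_atTop b] with k hk
      exact hanti b (t k) hb hk
    -- bound on the derivative
    obtain ⟨C, hC⟩ : ∃ C, ∀ s, 0 ≤ s → ‖rhs 0 (A s)‖ ≤ C := by
      obtain ⟨C, hC⟩ := (isCompact_closedBall (0 : M4)
        (Real.sqrt (nsq (A 0)))).exists_bound_of_continuousOn cd_rhs.continuous.continuousOn
      refine ⟨C, fun s hs => hC _ ?_⟩
      rw [mem_closedBall_zero_iff]
      exact norm_le_of_nsq (hanti 0 s le_rfl hs)
    have hC0 : 0 ≤ C := (norm_nonneg _).trans (hC 0 le_rfl)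
    have hlip : ∀ a b, 0 ≤ a → a ≤ b → ‖A b - A a‖ ≤ C * (b - a) := by
      intro a b ha hab
      have := (convex_Ici (0:ℝ)).norm_image_sub_le_of_norm_hasDerivWithin_le hA
        (fun s hs => hC s hs) (show a ∈ Set.Ici (0:ℝ) from ha)
        (show b ∈ Set.Ici (0:ℝ) from ha.trans hab)
      rwa [Real.norm_eq_abs, abs_of_nonneg (sub_nonneg.2 hab)] at this
    have key : nsq (symPart Abar) = 0 := by
      by_contra hne
      have hpos : 0 < nsq (symPart Abar) := lt_of_le_of_ne (nsq_nonneg _) (Ne.symm hne)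
      set s := nsq (symPart Abar) with hs
      have hsc : Continuous (fun X : M4 => nsq (symPart X)) := (cd_nsq cd_sym).continuous
      have hev := hsc.continuousAt (x := Abar) |>.eventually (lt_mem_nhds (half_lt_self hpos))
      obtain ⟨ε, hε, hball⟩ := Metric.eventually_nhds_iff.1 hev
      set η := ε / (2 * (C + 1)) with hη
      have hη0 : 0 < η := by positivity
      have hCη : C * η < ε / 2 := by
        have : (C + 1) * η = ε / 2 := by rw [hη]; field_simp
        linarith
      have h1 : ∀ᶠ k in Filter.atTop, dist (A (t k)) Abar < ε / 2 :=
        (Metric.tendsto_nhds.1 hconv) _ (by positivity)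
      have h2 : ∀ᶠ k in Filter.atTop, nsq (A (t k)) < nsq Abar + 2 * (s / 2) ^ 2 * η :=
        hlim.eventually (gt_mem_nhds (by
          have : 0 < 2 * (s / 2) ^ 2 * η := by positivity
          linarith))
      obtain ⟨k, hk1, hk2⟩ := (h1.and h2).exists
      have := decr (d := 2 * (s / 2) ^ 2) hN (ht0 k) (show t k ≤ t k + η by linarith) (by
        intro x hx
        have hd : dist (A x) Abar < ε := by
          have h3 := hlip (t k) x (ht0 k) hx.1
          have h4 : C * (x - t k) ≤ C * η :=
            mul_le_mul_of_nonneg_left (by linarith [hx.2]) hC0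
          have h5 := dist_triangle (A x) (A (t k)) Abar
          rw [dist_eq_norm (A x) (A (t k))] at h5
          linarith
        have h6 : s / 2 < nsq (symPart (A x)) := hball hd
        have h7 := energy' (A x)
        have h8 : (s / 2) ^ 2 ≤ nsq (symPart (A x)) ^ 2 :=
          pow_le_pow_left₀ (by positivity) h6.le 2
        linarith)
      have h9 := hlow (t k + η) (by linarith [ht0 k])
      have h10 : t k + η - t k = η := by ring
      rw [h10] at this
      linarith
    have h0 := nsq_eq_zero key
    unfold symPart at h0
    exact (smul_eq_zero.1 h0).resolve_left (by norm_num)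
  · have hall : ∀ T, 0 ≤ T → conjJ (A T) = A T := by
      intro T hT
      have hB : ∀ t ∈ Set.Ici (0 : ℝ),
          HasDerivWithinAt (fun t => conjJ (A t)) (rhs 0 (conjJ (A t))) (Set.Ici 0) t := by
        intro t ht
        rw [← conjJ_rhs]
        exact conjJ_deriv (hA t ht)
      have hcontB : ContinuousOn (fun t => conjJ (A t)) (Set.Ici 0) :=
        fun t ht => (hB t ht).continuousWithinAt
      have hsub : Set.Icc 0 T ⊆ Set.Ici (0:ℝ) := fun x hx => hx.1
      obtain ⟨R1, hR1⟩ := isCompact_Icc.exists_bound_of_continuousOn (hcont.mono hsub)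
      obtain ⟨R2, hR2⟩ := isCompact_Icc.exists_bound_of_continuousOn (hcontB.mono hsub)
      obtain ⟨K, hK⟩ := cd_rhs.contDiffOn.exists_lipschitzOnWith one_ne_zero
        (convex_closedBall (0 : M4) (max R1 R2)) (isCompact_closedBall _ _)
      have := ODE_solution_unique_of_mem_Icc_right (v := fun _ X => rhs 0 X)
        (s := fun _ => Metric.closedBall (0 : M4) (max R1 R2)) (K := K) (a := 0) (b := T)
        (f := fun t => conjJ (A t)) (g := A)
        (fun _ _ => hK) (hcontB.mono hsub)
        (fun t ht => (hB t ht.1).mono (Set.Ici_subset_Ici.2 ht.1))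
        (fun t ht => mem_closedBall_zero_iff.2
          ((hR2 t ⟨ht.1, ht.2.le⟩).trans (le_max_right _ _)))
        (hcont.mono hsub)
        (fun t ht => (hA t ht.1).mono (Set.Ici_subset_Ici.2 ht.1))
        (fun t ht => mem_closedBall_zero_iff.2
          ((hR1 t ⟨ht.1, ht.2.le⟩).trans (le_max_left _ _)))
        ((conjJ_iff _).2 hJ)
      exact this ⟨hT, le_rfl⟩
    have hmulc : ∀ k, A (t k) * J4 = J4 * A (t k) := fun k =>
      (conjJ_iff _).1 (hall _ (ht0 k))
    have hl : Filter.Tendsto (fun k => A (t k) * J4) Filter.atTop (nhds (Abar * J4)) :=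
      ((cd_mul contDiff_id contDiff_const).continuous.tendsto Abar).comp hconv
    have hr : Filter.Tendsto (fun k => J4 * A (t k)) Filter.atTop (nhds (J4 * Abar)) :=
      ((cd_mul contDiff_const contDiff_id).continuous.tendsto Abar).comp hconv
    simp only [hmulc] at hl
    exact tendsto_nhds_unique hl hr
end
end
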